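/- Define partial transformations s0 and s1 on 6-tuples (α0, α1, α2; f0, f1, f2) of complex numbers by s0(α0, α1, α2; f0, f1, f2) = (−α0, α1 + α0, α2 + α0; f0, f1 − α0/f0, f2 + α0/f0) (defined when f0 ≠ 0) and s1(α0, α1, α2; f0, f1, f2) = (α0 + α1, −α1, α2 + α1; f0 + α1/f1, f1, f2 − α1/f1) (defined when f1 ≠ 0). Then: (i) s0(s0(α; f)) = (α; f) whenever f0 ≠ 0, and s1(s1(α; f)) = (α; f) whenever f1 ≠ 0; (ii) for any tuple with f0 ≠ 0, f1 ≠ 0, f0·f1 − α0 ≠ 0 and f0·f1 + α1 ≠ 0, both triple composites are defined and the braid relation holds: s0(s1(s0(α; f))) = s1(s0(s1(α; f))). Hence s0, s1 generate a representation of the Weyl group relations of type A2 by birational transformations. -/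

import Mathlib

/-- The Bäcklund transformation `s₀` of the symmetric Painlevé IV system, as a
(birational) map of `ℂ⁶ = {(α₀, α₁, α₂; f₀, f₁, f₂)}`. -/
noncomputable def backlundS0 : ℂ × ℂ × ℂ × ℂ × ℂ × ℂ → ℂ × ℂ × ℂ × ℂ × ℂ × ℂ :=
  fun (a0, a1, a2, f0, f1, f2) =>
    (-a0, a1 + a0, a2 + a0, f0, f1 - a0 / f0, f2 + a0 / f0)

/-- The Bäcklund transformation `s₁` of the symmetric Painlevé IV system, as a
(birational) map of `ℂ⁶ = {(α₀, α₁, α₂; f₀, f₁, f₂)}`. -/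
noncomputable def backlundS1 : ℂ × ℂ × ℂ × ℂ × ℂ × ℂ → ℂ × ℂ × ℂ × ℂ × ℂ × ℂ :=
  fun (a0, a1, a2, f0, f1, f2) =>
    (a0 + a1, -a1, a2 + a1, f0 + a1 / f1, f1, f2 - a1 / f1)

/-- The value of `f₀` after `s₁ ∘ s₀`; in particular it is nonzero where the braid relation
is asserted. -/
theorem add_div_sub_div_eq {a b x y : ℂ} (hx : x ≠ 0) (hxy : x * y - a ≠ 0) :
    x + (b + a) / (y - a / x) = x * (x * y + b) / (x * y - a) := by
  rw [sub_div' hx, mul_comm y x]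
  field_simp
  ring

/-- The value of `f₁` after `s₀ ∘ s₁`; in particular it is nonzero where the braid relation
is asserted. -/
theorem sub_div_add_div_eq {a b x y : ℂ} (hy : y ≠ 0) (hxy : x * y + b ≠ 0) :
    y - (a + b) / (x + b / y) = y * (x * y - a) / (x * y + b) := by
  rw [add_div_eq_mul_add_div _ _ hy, div_div_eq_mul_div, sub_div' hxy]
  ring

/-- **Weyl group relations of type `A₂` for the Bäcklund transformations `s₀, s₁`.**
(i) `s₀` and `s₁` are involutions (wherever defined);
(ii) under the stated nonvanishing conditions the braid relation
`s₀s₁s₀ = s₁s₀s₁` holds. -/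
theorem backlund_weyl_relations
    (a0 a1 a2 f0 f1 f2 : ℂ) :
    (f0 ≠ 0 → backlundS0 (backlundS0 (a0, a1, a2, f0, f1, f2)) =
      (a0, a1, a2, f0, f1, f2)) ∧
    (f1 ≠ 0 → backlundS1 (backlundS1 (a0, a1, a2, f0, f1, f2)) =
      (a0, a1, a2, f0, f1, f2)) ∧
    (f0 ≠ 0 → f1 ≠ 0 → f0 * f1 - a0 ≠ 0 → f0 * f1 + a1 ≠ 0 →
      backlundS0 (backlundS1 (backlundS0 (a0, a1, a2, f0, f1, f2))) =
      backlundS1 (backlundS0 (backlundS1 (a0, a1, a2, f0, f1, f2)))) := by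
  refine ⟨fun _ => ?_, fun _ => ?_, fun h0 h1 hm hp => ?_⟩
  · simp [backlundS0, neg_div]
  · simp [backlundS1, neg_div]
  · simp only [backlundS0, backlundS1, Prod.mk.injEq, add_div_sub_div_eq h0 hm,
      sub_div_add_div_eq h1 hp]
    rw [sub_div' h0, mul_comm f1 f0, add_div_eq_mul_add_div _ _ h1]
    refine ⟨?_, ?_, ?_, ?_, ?_, ?_⟩
    · ring
    · ring
    · ring
    all_goals
      field_simp
      ring
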